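/- arXiv:1512.01994 — 2 statements merged into one kernel-verified Lean document; each statement's English description precedes it below -/
import Mathlib

section
/- Let G be a finite simple graph, Γ ⊆ Ω(G), and let Γ' be a nonempty subfamily of MaxCritIndep(G) such that for every A ∈ Γ' there exists S ∈ Γ with A ⊆ S. If ⋂Γ is a critical set, then ⋂Γ ⊆ ⋂Γ'. -/
/-- `S` is an independent set in `G`: no two of its vertices are adjacent. -/
def IndepSet {V : Type*} (G : SimpleGraph V) (S : Set V) : Prop :=
  ∀ ⦃u⦄, u ∈ S → ∀ ⦃v⦄, v ∈ S → ¬G.Adj u v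

/-- The independence number `α(G)`. -/
noncomputable def indNum {V : Type*} (G : SimpleGraph V) : ℕ :=
  sSup {n : ℕ | ∃ S : Set V, IndepSet G S ∧ S.ncard = n}

/-- `Ω(G)`: the family of maximum independent sets of `G`. -/
def maxIndepFam {V : Type*} (G : SimpleGraph V) : Set (Set V) :=
  {S | IndepSet G S ∧ S.ncard = indNum G}

/-- `N(X)`: the neighborhood of a set of vertices. -/
def nbhd {V : Type*} (G : SimpleGraph V) (X : Set V) : Set V :=
  {v | ∃ x ∈ X, G.Adj v x}

/-- `N[X] = N(X) ∪ X`: the closed neighborhood of a set of vertices. -/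
def closedNbhd {V : Type*} (G : SimpleGraph V) (X : Set V) : Set V :=
  nbhd G X ∪ X

/-- The difference `d(X) = |X| - |N(X)|`. -/
noncomputable def diffd {V : Type*} (G : SimpleGraph V) (X : Set V) : ℤ :=
  (X.ncard : ℤ) - ((nbhd G X).ncard : ℤ)

/-- The critical difference `d(G) = max {d(X) : X ⊆ V(G)}`. -/
noncomputable def critDiff {V : Type*} (G : SimpleGraph V) : ℤ :=
  sSup {d : ℤ | ∃ X : Set V, diffd G X = d}

/-- `X` is a critical set if `d(X) = d(G)`. -/
def IsCritical {V : Type*} (G : SimpleGraph V) (X : Set V) : Prop :=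
  diffd G X = critDiff G

/-- `MaxCritIndep(G)`: the family of critical independent sets of maximum cardinality. -/
def maxCritIndepFam {V : Type*} (G : SimpleGraph V) : Set (Set V) :=
  {S | IndepSet G S ∧ IsCritical G S ∧
    ∀ T : Set V, IndepSet G T → IsCritical G T → T.ncard ≤ S.ncard}

/-- The critical independence number `α'(G)`. -/
noncomputable def critIndNum {V : Type*} (G : SimpleGraph V) : ℕ :=
  sSup {n : ℕ | ∃ S : Set V, IndepSet G S ∧ IsCritical G S ∧ S.ncard = n}

/-- `ker(G)`: the intersection of all critical independent sets. -/
def kerSet {V : Type*} (G : SimpleGraph V) : Set V :=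
  ⋂₀ {A : Set V | IndepSet G A ∧ IsCritical G A}

/-- `nucleus(G)`: the intersection of all maximum critical independent sets. -/
def nucleus {V : Type*} (G : SimpleGraph V) : Set V :=
  ⋂₀ maxCritIndepFam G

/-- `diadem(G)`: the union of all maximum critical independent sets. -/
def diadem {V : Type*} (G : SimpleGraph V) : Set V :=
  ⋃₀ maxCritIndepFam G

/-- `core(G)`: the intersection of all maximum independent sets. -/
def coreSet {V : Type*} (G : SimpleGraph V) : Set V :=
  ⋂₀ maxIndepFam G

/-- `corona(G)`: the union of all maximum independent sets. -/
def coronaSet {V : Type*} (G : SimpleGraph V) : Set V :=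
  ⋃₀ maxIndepFam G

/-- A matching in `G`: a set of pairwise non-incident edges of `G`. -/
def IsMatchingSet {V : Type*} (G : SimpleGraph V) (M : Set (Sym2 V)) : Prop :=
  M ⊆ G.edgeSet ∧ M.Pairwise fun e f => ∀ v, v ∈ e → v ∉ f

/-- The matching number `μ(G)`. -/
noncomputable def matchNum {V : Type*} (G : SimpleGraph V) : ℕ :=
  sSup {n : ℕ | ∃ M : Set (Sym2 V), IsMatchingSet G M ∧ M.ncard = n}

/-- `G` is a König-Egerváry graph if `α(G) + μ(G) = |V(G)|`. -/
def IsKonigEgervary {V : Type*} (G : SimpleGraph V) : Prop :=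
  indNum G + matchNum G = Nat.card V

/-- `Γ` is a König-Egerváry collection: a family of independent sets with
`|⋂Γ| + |⋃Γ| = 2α(G)`. -/
def IsKECollection {V : Type*} (G : SimpleGraph V) (Γ : Set (Set V)) : Prop :=
  (∀ S ∈ Γ, IndepSet G S) ∧ (⋂₀ Γ).ncard + (⋃₀ Γ).ncard = 2 * indNum G

theorem IndepSet.subset {V : Type*} {G : SimpleGraph V} {S T : Set V} (hS : IndepSet G S)
    (h : T ⊆ S) : IndepSet G T :=
  fun _ hu _ hv => hS (h hu) (h hv)

theorem diffd_le_critDiff {V : Type*} [Finite V] (G : SimpleGraph V) (X : Set V) :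
    diffd G X ≤ critDiff G :=
  le_csSup (Set.finite_range (diffd G)).bddAbove ⟨X, rfl⟩

theorem nbhd_union {V : Type*} (G : SimpleGraph V) (A B : Set V) :
    nbhd G (A ∪ B) = nbhd G A ∪ nbhd G B := by
  ext v
  simp [nbhd, or_and_right, exists_or]

theorem nbhd_inter_subset {V : Type*} (G : SimpleGraph V) (A B : Set V) :
    nbhd G (A ∩ B) ⊆ nbhd G A ∩ nbhd G B := by
  rintro v ⟨x, ⟨hA, hB⟩, h⟩
  exact ⟨⟨x, hA, h⟩, ⟨x, hB, h⟩⟩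

theorem diffd_add_diffd_le {V : Type*} [Finite V] (G : SimpleGraph V) (A B : Set V) :
    diffd G A + diffd G B ≤ diffd G (A ∪ B) + diffd G (A ∩ B) := by
  have hX := Set.ncard_union_add_ncard_inter A B
  have hN := Set.ncard_union_add_ncard_inter (nbhd G A) (nbhd G B)
  have hle := Set.ncard_le_ncard (nbhd_inter_subset G A B)
  unfold diffd
  rw [nbhd_union]
  omega

theorem IsCritical.union {V : Type*} [Finite V] {G : SimpleGraph V} {A B : Set V}
    (hA : IsCritical G A) (hB : IsCritical G B) : IsCritical G (A ∪ B) := by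
  have hsum := diffd_add_diffd_le G A B
  have hunion := diffd_le_critDiff G (A ∪ B)
  have hinter := diffd_le_critDiff G (A ∩ B)
  unfold IsCritical at *
  omega

/-- If `Γ ⊆ Ω(G)`, `Γ'` is a nonempty subfamily of `MaxCritIndep(G)` such
that every `A ∈ Γ'` is contained in some `S ∈ Γ`, and `⋂Γ` is a critical set, then
`⋂Γ ⊆ ⋂Γ'`. -/
theorem stmt6 {V : Type*} [Fintype V] (G : SimpleGraph V)
    (Γ Γ' : Set (Set V)) (hΓ : Γ ⊆ maxIndepFam G)
    (hne' : Γ'.Nonempty) (hΓ' : Γ' ⊆ maxCritIndepFam G)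
    (hcov : ∀ A ∈ Γ', ∃ S ∈ Γ, A ⊆ S)
    (hcrit : IsCritical G (⋂₀ Γ)) :
    ⋂₀ Γ ⊆ ⋂₀ Γ' := by
  refine Set.subset_sInter fun A hA => ?_
  obtain ⟨S, hS, hAS⟩ := hcov A hA
  obtain ⟨-, hAcrit, hAmax⟩ := hΓ' hA
  have hindep : IndepSet G (A ∪ ⋂₀ Γ) :=
    (hΓ hS).1.subset (Set.union_subset hAS (Set.sInter_subset_of_mem hS))
  have heq : A = A ∪ ⋂₀ Γ :=
    Set.eq_of_subset_of_ncard_le Set.subset_union_left (hAmax _ hindep (hAcrit.union hcrit))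
  exact Set.union_eq_left.mp heq.symm
end

section
/- Let G be a finite simple graph and let Γ be a nonempty subfamily of Ω(G). If Γ' ⊆ Ind(G) is a nonempty family with Γ' ◁ Γ, then |⋂Γ'| + |⋃Γ'| ≤ |⋂Γ| + |⋃Γ|. -/
theorem IndepSet.mono {V : Type*} {G : SimpleGraph V} {S T : Set V} (hT : IndepSet G T)
    (h : S ⊆ T) : IndepSet G S :=
  fun _ hu _ hv => hT (h hu) (h hv)

theorem IndepSet.ncard_le_indNum {V : Type*} [Finite V] {G : SimpleGraph V} {S : Set V}
    (hS : IndepSet G S) : S.ncard ≤ indNum G := by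
  refine le_csSup ⟨Nat.card V, ?_⟩ ⟨S, hS, rfl⟩
  rintro n ⟨T, -, rfl⟩
  exact Set.ncard_le_card T

/-- Exchanging the neighbors of `X` in a maximum independent set `S` for `X` cannot enlarge `S`. -/
theorem IndepSet.ncard_le_ncard_nbhd_inter {V : Type*} [Finite V] {G : SimpleGraph V}
    {X S : Set V} (hX : IndepSet G X) (hS : S ∈ maxIndepFam G) (hd : Disjoint X S) :
    X.ncard ≤ (nbhd G X ∩ S).ncard := by
  have hind : IndepSet G (X ∪ (S \ nbhd G X)) := by
    rintro u (hu | ⟨hu, hu'⟩) v (hv | ⟨hv, hv'⟩) huv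
    · exact hX hu hv huv
    · exact hv' ⟨u, hu, huv.symm⟩
    · exact hu' ⟨v, hv, huv⟩
    · exact hS.1 hu hv huv
  have hle := hind.ncard_le_indNum
  rw [Set.ncard_union_eq (hd.mono_right Set.sdiff_subset), ← hS.2] at hle
  have hsplit := Set.ncard_inter_add_ncard_sdiff_eq_ncard S (nbhd G X)
  rw [Set.inter_comm] at hsplit
  omega

theorem IndepSet.ncard_diff_sInter_le {V : Type*} [Finite V] {G : SimpleGraph V}
    {X : Set V} (hX : IndepSet G X) {Γ : Set (Set V)} (hΓ : Γ ⊆ maxIndepFam G) :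
    (X \ ⋂₀ Γ).ncard ≤ (nbhd G (X \ ⋂₀ Γ) ∩ ⋃₀ Γ).ncard := by
  induction Γ, Γ.toFinite using Set.Finite.induction_on generalizing X with
  | empty => simp
  | @insert S Γ _ _ ih =>
    have hS : S ∈ maxIndepFam G := hΓ (Set.mem_insert S Γ)
    have hout := (hX.mono (Set.sdiff_subset (t := S))).ncard_le_ncard_nbhd_inter hS
      Set.disjoint_sdiff_left
    have hin := ih (hX.mono (Set.inter_subset_left (t := S)))
      ((Set.subset_insert S Γ).trans hΓ)
    have hdisj : Disjoint (nbhd G (X \ S) ∩ S)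
        (nbhd G ((X ∩ S) \ ⋂₀ Γ) ∩ ⋃₀ Γ) := by
      rw [Set.disjoint_left]
      rintro v ⟨-, hv⟩ ⟨⟨x, hx, hvx⟩, -⟩
      exact hS.1 hv hx.1.2 hvx
    have hX_eq : X \ ⋂₀ insert S Γ = (X \ S) ∪ ((X ∩ S) \ ⋂₀ Γ) := by
      ext v
      simp only [Set.sInter_insert, Set.mem_sdiff, Set.mem_inter_iff, Set.mem_union]
      tauto
    rw [hX_eq]
    refine (Set.ncard_union_le _ _).trans ((Nat.add_le_add hout hin).trans ?_)
    rw [← Set.ncard_union_eq hdisj]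
    refine Set.ncard_le_ncard ?_
    rintro v (⟨⟨x, hx, hvx⟩, hv⟩ | ⟨⟨x, hx, hvx⟩, T, hT, hv⟩)
    · exact ⟨⟨x, Or.inl hx, hvx⟩, S, Set.mem_insert S Γ, hv⟩
    · exact ⟨⟨x, Or.inr hx, hvx⟩, T, Set.mem_insert_of_mem S hT, hv⟩

/-- If `Γ` is a nonempty subfamily of `Ω(G)` and `Γ' ⊆ Ind(G)` is a
nonempty family with `Γ' ◁ Γ` (i.e. `⋃Γ' ⊆ ⋃Γ` and `⋂Γ ⊆ ⋂Γ'`), then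
`|⋂Γ'| + |⋃Γ'| ≤ |⋂Γ| + |⋃Γ|`. -/
theorem stmt14 {V : Type*} [Fintype V] (G : SimpleGraph V)
    (Γ Γ' : Set (Set V)) (hne : Γ.Nonempty) (hΓ : Γ ⊆ maxIndepFam G)
    (hne' : Γ'.Nonempty) (hΓ' : ∀ S ∈ Γ', IndepSet G S)
    (hU : ⋃₀ Γ' ⊆ ⋃₀ Γ) (hI : ⋂₀ Γ ⊆ ⋂₀ Γ') :
    (⋂₀ Γ').ncard + (⋃₀ Γ').ncard ≤ (⋂₀ Γ).ncard + (⋃₀ Γ).ncard := by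
  obtain ⟨S, hS⟩ := hne'
  have hind : IndepSet G (⋂₀ Γ') := (hΓ' S hS).mono (Set.sInter_subset_of_mem hS)
  have hsub : nbhd G (⋂₀ Γ' \ ⋂₀ Γ) ∩ ⋃₀ Γ ⊆ ⋃₀ Γ \ ⋃₀ Γ' := by
    rintro v ⟨⟨x, hx, hvx⟩, hv⟩
    refine ⟨hv, ?_⟩
    rintro ⟨T, hT, hvT⟩
    exact hΓ' T hT hvT (hx.1 T hT) hvx
  have hle := (hind.ncard_diff_sInter_le hΓ).trans (Set.ncard_le_ncard hsub)
  have hInter := Set.ncard_sdiff_add_ncard_of_subset hI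
  have hUnion := Set.ncard_sdiff_add_ncard_of_subset hU
  omega
end
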